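/- For every finite field extension κ of ℂ((t)), the Brauer group Br(κ) is trivial. -/

import Mathlib

/-!
Statement 1: For every finite field extension `κ` of `ℂ((t))`, the Brauer group
`Br(κ)` is trivial.

Since every class in the Brauer group of a field `κ` is represented by a unique
finite-dimensional central division algebra over `κ`, the triviality of `Br(κ)` is
expressed by saying that every finite-dimensional central division algebra over `κ`
is `κ` itself, i.e. has dimension `1` over `κ`.
-/

open Polynomial

/-- An element of a finite-dimensional division algebra has a conjugate in any algebraically closed
extension of the base field. -/
theorem exists_forall_minpoly_aeval_eq {K D : Type*} (E : Type*) [Field K] [DivisionRing D]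
    [Algebra K D] [FiniteDimensional K D] [Field E] [Algebra K E] [IsAlgClosed E] (x : D) :
    ∃ r : E, ∀ q : K[X], minpoly K (aeval x q) = minpoly K (aeval r q) := by
  have hx : IsIntegral K x := Algebra.IsIntegral.isIntegral x
  obtain ⟨r, hr⟩ := IsAlgClosed.exists_aeval_eq_zero E (minpoly K x) (minpoly.degree_pos hx).ne'
  refine ⟨r, fun q ↦ ?_⟩
  have hq : IsIntegral K (aeval x q) := Algebra.IsIntegral.isIntegral _
  refine minpoly.eq_of_irreducible_of_monic (minpoly.irreducible hq) ?_ (minpoly.monic hq)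
  rw [← aeval_comp]
  obtain ⟨s, hs⟩ := minpoly.dvd K x (p := (minpoly K (aeval x q)).comp q)
    (by rw [aeval_comp, minpoly.aeval])
  rw [hs, map_mul, hr, zero_mul]

/-- The norm of an element of a finite-dimensional division algebra over a complete ultrametric field
has absolute value a power of the spectral value of its minimal polynomial. -/
theorem norm_algebraNorm_eq_spectralValue_pow {K D : Type*} [NontriviallyNormedField K]
    [IsUltrametricDist K] [CompleteSpace K] [DivisionRing D] [Algebra K D] [FiniteDimensional K D]
    (x : D) :
    ‖Algebra.norm K x‖ = spectralValue (minpoly K x) ^ Module.finrank K D := by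
  classical
  let E := AlgebraicClosure K
  let f : Module.End K D := Algebra.lmul K D x
  let A := LinearMap.toMatrix (Module.finBasis K D) (Module.finBasis K D) f
  let B : Matrix _ _ E := A.map (algebraMap K E)
  have hx : IsIntegral K x := Algebra.IsIntegral.isIntegral x
  have hA : aeval A (minpoly K x) = 0 := by
    have h1 : A = (LinearMap.toMatrixAlgEquiv (Module.finBasis K D)).toAlgHom
      ((Algebra.lmul K D) x) := rfl
    rw [h1, aeval_algHom_apply, aeval_algHom_apply, minpoly.aeval, map_zero, map_zero]
  have hB : aeval B ((minpoly K x).map (algebraMap K E)) = 0 := by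
    have h1 : B = (Algebra.ofId K E).mapMatrix A := rfl
    rw [aeval_map_algebraMap, h1, aeval_algHom_apply, hA, map_zero]
  have hroot (r : E) (hr : r ∈ B.charpoly.roots) :
      spectralMulAlgNorm K E r = spectralValue (minpoly K x) := by
    have hr' := (Matrix.mem_spectrum_iff_isRoot_charpoly).2 (isRoot_of_mem_roots hr)
    rw [← Matrix.spectrum_toLin', ← Module.End.hasEigenvalue_iff_mem_spectrum,
      Module.End.hasEigenvalue_iff_isRoot] at hr'
    have hdvd := minpoly.dvd E B hB
    rw [← Matrix.minpoly_toLin'] at hdvd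
    have h0 := hr'.dvd hdvd
    rw [IsRoot.def, eval_map_algebraMap] at h0
    rw [spectralMulAlgNorm_def, spectralNorm,
      ← minpoly.eq_of_irreducible_of_monic (minpoly.irreducible hx) h0 (minpoly.monic hx)]
  have hdet : algebraMap K E (Algebra.norm K x) = B.charpoly.roots.prod := by
    rw [← Matrix.det_eq_prod_roots_charpoly, Algebra.norm_apply,
      ← LinearMap.det_toMatrix (Module.finBasis K D), RingHom.map_det]
    rfl
  rw [← spectralNorm_extends (L := E), hdet, ← spectralMulAlgNorm_def, map_multiset_prod,
    Multiset.map_congr rfl (g := fun _ ↦ spectralValue (minpoly K x)) hroot,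
    Multiset.map_const', Multiset.prod_replicate,
    ← (IsAlgClosed.splits B.charpoly).natDegree_eq_card_roots,
    Matrix.charpoly_natDegree_eq_dim, Fintype.card_fin]

/-- The absolute value of the algebra norm satisfies the strong triangle inequality. -/
theorem norm_algebraNorm_add_le {K D : Type*} [NontriviallyNormedField K]
    [IsUltrametricDist K] [CompleteSpace K] [DivisionRing D] [Algebra K D] [FiniteDimensional K D]
    (x y : D) :
    ‖Algebra.norm K (x + y)‖ ≤ max ‖Algebra.norm K x‖ ‖Algebra.norm K y‖ := by
  rcases eq_or_ne y 0 with rfl | hy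
  · simp
  set z := x * y⁻¹
  have hx : x = z * y := by simp [z, hy]
  obtain ⟨r, hr⟩ := exists_forall_minpoly_aeval_eq (K := K) (AlgebraicClosure K) z
  have hrz : minpoly K z = minpoly K r := by simpa only [aeval_X] using hr X
  have hrz1 : minpoly K (z + 1) = minpoly K (r + 1) := by
    have h := hr (X + 1)
    rwa [map_add, map_add, aeval_X, aeval_X, map_one, map_one] at h
  have hz : ‖Algebra.norm K z‖ = spectralNorm K (AlgebraicClosure K) r ^ Module.finrank K D := by
    rw [norm_algebraNorm_eq_spectralValue_pow, spectralNorm, hrz]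
  have hz1 : ‖Algebra.norm K (z + 1)‖ =
      spectralNorm K (AlgebraicClosure K) (r + 1) ^ Module.finrank K D := by
    rw [norm_algebraNorm_eq_spectralValue_pow, spectralNorm, hrz1]
  have h : ‖Algebra.norm K (z + 1)‖ ≤ max ‖Algebra.norm K z‖ 1 := by
    have hadd := isNonarchimedean_spectralNorm (K := K) (L := AlgebraicClosure K) r 1
    rw [spectralNorm_one] at hadd
    rw [hz, hz1]
    refine (pow_le_pow_left₀ (spectralNorm_nonneg _) hadd _).trans ?_
    rcases le_total (spectralNorm K (AlgebraicClosure K) r) 1 with h | h <;> simp [h]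
  have hxy : x + y = (z + 1) * y := by rw [add_mul, one_mul, ← hx]
  rw [hxy, hx, map_mul, map_mul, norm_mul, norm_mul]
  calc _ ≤ max ‖Algebra.norm K z‖ 1 * ‖Algebra.norm K y‖ := by gcongr
    _ = _ := by rw [max_mul_of_nonneg _ _ (norm_nonneg _), one_mul]

/-- The absolute value on a finite-dimensional division algebra over a complete ultrametric field
given by the norm of the determinant of left multiplication. -/
noncomputable def algebraNormAbs (K D : Type*) [NontriviallyNormedField K]
    [IsUltrametricDist K] [CompleteSpace K] [DivisionRing D] [Algebra K D]
    [FiniteDimensional K D] : AbsoluteValue D ℝ where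
  toFun x := ‖Algebra.norm K x‖
  map_mul' x y := by simp
  nonneg' _ := norm_nonneg _
  eq_zero' x := by
    refine ⟨fun h ↦ by_contra fun hx ↦ ?_, ?_⟩
    · have h1 : ‖Algebra.norm K (x * x⁻¹)‖ = 1 := by simp [hx]
      rw [map_mul, norm_mul, h, zero_mul] at h1
      exact zero_ne_one h1
    · rintro rfl
      rw [← zero_smul K (1 : D), Algebra.smul_def, map_mul, Algebra.norm_algebraMap,
        zero_pow Module.finrank_pos.ne', zero_mul, norm_zero]
  add_le' x y := (norm_algebraNorm_add_le x y).trans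
    (max_le_add_of_nonneg (norm_nonneg _) (norm_nonneg _))

/-- If every residue class is represented by a scalar, integral elements are approximated to any order
by polynomials in a uniformizer `π`. -/
theorem exists_mem_adjoin_sub_le_pow {K D : Type*} [Field K] [DivisionRing D] [Algebra K D]
    (v : AbsoluteValue D ℝ) (hres : ∀ x, v x ≤ 1 → ∃ c : K, v (x - algebraMap K D c) < 1)
    {π : D} (hπ : π ≠ 0) (hmax : ∀ x, v x < 1 → v x ≤ v π) {x : D} (hx : v x ≤ 1) (m : ℕ) :
    ∃ a ∈ Algebra.adjoin K {π}, v (x - a) ≤ v π ^ m := by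
  have hmem : π ∈ Algebra.adjoin K {π} := Algebra.self_mem_adjoin_singleton K π
  induction m with
  | zero => exact ⟨0, zero_mem _, by simpa using hx⟩
  | succ m ih =>
    obtain ⟨a, ha, hxa⟩ := ih
    have hπm : π ^ m ≠ 0 := pow_ne_zero m hπ
    obtain ⟨c, hc⟩ := hres ((x - a) * (π ^ m)⁻¹) (by
      rw [map_mul, map_inv₀, map_pow]
      exact mul_inv_le_one_of_le₀ hxa (by positivity))
    refine ⟨a + algebraMap K D c * π ^ m,
      add_mem ha (mul_mem (Subalgebra.algebraMap_mem _ c) (pow_mem hmem m)), ?_⟩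
    have h : x - (a + algebraMap K D c * π ^ m) =
        ((x - a) * (π ^ m)⁻¹ - algebraMap K D c) * π ^ m := by
      rw [sub_mul, inv_mul_cancel_right₀ hπm, sub_sub]
    rw [h, map_mul, map_pow, pow_succ']
    gcongr
    exact hmax _ hc

/-- A division algebra with a discrete nonarchimedean absolute value is commutative if every
residue class is represented by a scalar. -/
theorem mul_comm_of_isNonarchimedean {K D : Type*} [Field K] [DivisionRing D] [Algebra K D]
    (v : AbsoluteValue D ℝ) (hv : IsNonarchimedean v)
    (hres : ∀ x, v x ≤ 1 → ∃ c : K, v (x - algebraMap K D c) < 1)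
    {π : D} (hπ : π ≠ 0) (hπ1 : v π < 1) (hmax : ∀ x, v x < 1 → v x ≤ v π) (x y : D) :
    x * y = y * x := by
  have hsub (a b : D) : v (a - b) ≤ max (v a) (v b) := by
    simpa [sub_eq_add_neg] using hv a (-b)
  have key {x y : D} (hx : v x ≤ 1) (hy : v y ≤ 1) : Commute x y := by
    have hle (m : ℕ) : v (x * y - y * x) ≤ v π ^ m := by
      obtain ⟨a, ha, hxa⟩ := exists_mem_adjoin_sub_le_pow v hres hπ hmax hx m
      obtain ⟨b, hb, hyb⟩ := exists_mem_adjoin_sub_le_pow v hres hπ hmax hy m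
      have hab : a * b - b * a = 0 := sub_eq_zero.2 <|
        Algebra.commute_of_mem_adjoin_singleton_of_commute hb
          (Algebra.commute_of_mem_adjoin_self ha).symm
      have hπm : v π ^ m ≤ 1 := pow_le_one₀ (v.nonneg π) hπ1.le
      have ha1 : v a ≤ 1 := by
        simpa using (hsub x (x - a)).trans (max_le hx (hxa.trans hπm))
      have h : x * y - y * x =
          ((x - a) * y - y * (x - a)) + (a * (y - b) - (y - b) * a) := by
        rw [← add_zero (_ + _), ← hab]
        noncomm_ring
      rw [h]
      refine (hv _ _).trans (max_le ((hsub _ _).trans ?_) ((hsub _ _).trans ?_)) <;>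
      · simp only [map_mul]
        refine max_le ?_ ?_ <;> nlinarith [v.nonneg (x - a), v.nonneg (y - b)]
    refine sub_eq_zero.1 (v.eq_zero.1 (le_antisymm ?_ (v.nonneg _)))
    exact ge_of_tendsto' (tendsto_pow_atTop_nhds_zero_of_lt_one (v.nonneg π) hπ1) hle
  have hinv {x : D} (hx : ¬ v x ≤ 1) : v x⁻¹ ≤ 1 := by
    rw [map_inv₀]
    exact inv_le_one_of_one_le₀ (not_le.1 hx).le
  change Commute x y
  by_cases hx : v x ≤ 1 <;> by_cases hy : v y ≤ 1
  · exact key hx hy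
  · exact Commute.inv_right_iff₀.1 (key hx (hinv hy))
  · exact Commute.inv_left_iff₀.1 (key (hinv hx) hy)
  · exact Commute.inv_left_iff₀.1 (Commute.inv_right_iff₀.1 (key (hinv hx) (hinv hy)))

/-- If every monic polynomial with integral coefficients has a root modulo the maximal ideal, every
integral element of a finite-dimensional division algebra is congruent to a scalar. -/
theorem exists_norm_algebraNorm_sub_lt_one {K D : Type*} [NontriviallyNormedField K]
    [IsUltrametricDist K] [CompleteSpace K] [DivisionRing D] [Algebra K D] [FiniteDimensional K D]
    (hK : ∀ p : K[X], p.Monic → p.natDegree ≠ 0 → (∀ n, ‖p.coeff n‖ ≤ 1) → ∃ c, ‖p.eval c‖ < 1)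
    {x : D} (hx : ‖Algebra.norm K x‖ ≤ 1) :
    ∃ c : K, ‖Algebra.norm K (x - algebraMap K D c)‖ < 1 := by
  have hxi : IsIntegral K x := Algebra.IsIntegral.isIntegral x
  rw [norm_algebraNorm_eq_spectralValue_pow, pow_le_one_iff_of_nonneg (spectralValue_nonneg _)
    Module.finrank_pos.ne', spectralValue_le_one_iff (minpoly.monic hxi)] at hx
  obtain ⟨c, hc⟩ := hK _ (minpoly.monic hxi) (minpoly.natDegree_pos hxi).ne' hx
  refine ⟨c, ?_⟩
  obtain ⟨r, hr⟩ := exists_forall_minpoly_aeval_eq (K := K) (AlgebraicClosure K) x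
  have hrx : minpoly K x = minpoly K r := by simpa only [aeval_X] using hr X
  have hrc : minpoly K (x - algebraMap K D c) =
      minpoly K (r - algebraMap K (AlgebraicClosure K) c) := by
    have h := hr (X - C c)
    rwa [map_sub, map_sub, aeval_X, aeval_X, aeval_C, aeval_C] at h
  have hri : IsIntegral K (r - algebraMap K (AlgebraicClosure K) c) :=
    Algebra.IsIntegral.isIntegral _
  have hcoeff : (minpoly K (r - algebraMap K (AlgebraicClosure K) c)).coeff 0 =
      (minpoly K x).eval c := by
    rw [minpoly.sub_algebraMap, ← hrx, coeff_zero_eq_eval_zero]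
    simp
  rw [norm_algebraNorm_eq_spectralValue_pow, hrc]
  refine pow_lt_one₀ (spectralValue_nonneg _) ?_ Module.finrank_pos.ne'
  change spectralNorm K (AlgebraicClosure K) _ < 1
  rw [spectralNorm.spectralNorm_eq_norm_coeff_zero_rpow, hcoeff]
  refine Real.rpow_lt_one (norm_nonneg _) hc ?_
  have := minpoly.natDegree_pos hri
  positivity

open scoped LaurentSeries PowerSeries

/-- A monic polynomial with power series coefficients over an algebraically closed field has a root
modulo the maximal ideal. -/
theorem LaurentSeries.exists_valuation_eval_lt_one {F : Type*} [Field F] [IsAlgClosed F]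
    {p : F⸨X⸩[X]} (hp : p.Monic) (hdeg : p.natDegree ≠ 0)
    (hcoeff : ∀ n, Valued.v (p.coeff n) ≤ 1) : ∃ c, Valued.v (p.eval c) < 1 := by
  have hlift : p ∈ lifts (algebraMap F⟦X⟧ F⸨X⸩) := by
    rw [lifts_iff_coeff_lifts]
    exact fun n ↦ (LaurentSeries.val_le_one_iff_eq_coe F _).1 (hcoeff n)
  obtain ⟨q, rfl, hq, hqm⟩ := lifts_and_natDegree_eq_and_monic hlift hp
  obtain ⟨c, hc⟩ := IsAlgClosed.exists_root (q.map PowerSeries.constantCoeff) (by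
    rw [hqm.degree_map, degree_eq_natDegree hqm.ne_zero, hq]
    exact_mod_cast hdeg)
  refine ⟨algebraMap F⟦X⟧ F⸨X⸩ (PowerSeries.C c), ?_⟩
  rw [eval_map_algebraMap, aeval_algebraMap_apply]
  have h0 : PowerSeries.constantCoeff (q.eval (PowerSeries.C c)) = 0 := by
    have h := hom_eval₂ q (RingHom.id _) PowerSeries.constantCoeff (PowerSeries.C c)
    rw [PowerSeries.constantCoeff_C, RingHom.comp_id, eval₂_id] at h
    rw [h, ← eval_map, hc.eq_zero]
  have h1 := (LaurentSeries.intValuation_le_iff_coeff_lt_eq_zero F (d := 1)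
    (q.eval (PowerSeries.C c))).2 fun n hn ↦ by
      rwa [Nat.lt_one_iff.1 hn, PowerSeries.coeff_zero_eq_constantCoeff_apply]
  exact h1.trans_lt (by
    rw [← WithZero.exp_zero]
    exact WithZero.exp_lt_exp.2 (by norm_num))

theorem LaurentSeries.nonempty_rankOne (F : Type*) [Field F] :
    Nonempty (Valued.v : Valuation F⸨X⸩ (WithZero (Multiplicative ℤ))).RankOne :=
  ⟨@Valuation.IsRankOneDiscrete.rankOne _ _ _ _ (Valued.v : Valuation F⸨X⸩ _) (by
    rw [LaurentSeries.valuation_def]; infer_instance) 2 one_lt_two⟩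

open scoped Valued in
/-- A finite-dimensional division algebra over the field of Laurent series over an algebraically
closed field is commutative. -/
theorem mul_comm_of_laurentSeries {F D : Type*} [Field F] [IsAlgClosed F] [DivisionRing D]
    [Algebra F⸨X⸩ D] [FiniteDimensional F⸨X⸩ D] (x y : D) : x * y = y * x := by
  obtain ⟨_⟩ := LaurentSeries.nonempty_rankOne F
  let v := algebraNormAbs F⸨X⸩ D
  let N : D →* F⸨X⸩ := Algebra.norm F⸨X⸩
  have hN (x : D) : N x = 0 ↔ x = 0 := norm_eq_zero.symm.trans v.eq_zero
  let S : Set D := {x | x ≠ 0 ∧ Valued.v (N x) < 1}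
  have hS : S.Nonempty := by
    obtain ⟨a, ha0, ha1⟩ := NormedField.exists_norm_lt_one F⸨X⸩
    have ha : algebraMap F⸨X⸩ D a ≠ 0 := by simpa using ha0
    refine ⟨algebraMap F⸨X⸩ D a, ha, ?_⟩
    rw [Valued.toNormedField.norm_lt_one_iff] at ha1
    simp only [N, Algebra.norm_algebraMap, map_pow]
    exact pow_lt_one₀ zero_le ha1 Module.finrank_pos.ne'
  let g (x : D) : ℕ := (-WithZero.log (Valued.v (N x))).toNat
  obtain ⟨π, ⟨hπ0, hπ1⟩, hmin⟩ := exists_minimalFor_of_wellFoundedLT (· ∈ S) g hS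
  refine mul_comm_of_isNonarchimedean (K := F⸨X⸩) v (norm_algebraNorm_add_le (K := F⸨X⸩))
    (fun x hx ↦ ?_) hπ0 (Valued.toNormedField.norm_lt_one_iff.2 hπ1) (fun x hx ↦ ?_) x y
  · refine exists_norm_algebraNorm_sub_lt_one (fun p hp hdeg hcoeff ↦ ?_) hx
    simp only [Valued.toNormedField.norm_le_one_iff, Valued.toNormedField.norm_lt_one_iff] at *
    exact LaurentSeries.exists_valuation_eval_lt_one hp hdeg hcoeff
  · rcases eq_or_ne x 0 with rfl | hx0
    · simp
    have hx1 : Valued.v (N x) < 1 := Valued.toNormedField.norm_lt_one_iff.1 hx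
    refine Valued.toNormedField.norm_le_iff.2 ?_
    have hvx : Valued.v (N x) ≠ 0 := by simpa [hN] using hx0
    have hvπ : Valued.v (N π) ≠ 0 := by simpa [hN] using hπ0
    by_contra! hlt
    have hlt' := (WithZero.log_lt_log hvπ hvx).2 hlt
    have hneg := (WithZero.log_lt_log hvx one_ne_zero).2 hx1
    rw [WithZero.log_one] at hneg
    have := hmin ⟨hx0, hx1⟩ (by simp only [g]; omega)
    simp only [g] at this
    omega

/-- For every finite extension `κ` of `ℂ((t))`, the Brauer group of `κ`
is trivial: every finite-dimensional central division algebra `D` over `κ` has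
`dim_κ D = 1`. -/
theorem brauerGroup_of_finite_extension_of_laurentSeries_trivial
    (κ : Type) [Field κ] [Algebra (LaurentSeries ℂ) κ]
    [FiniteDimensional (LaurentSeries ℂ) κ]
    (D : Type) [DivisionRing D] [Algebra κ D] [Algebra.IsCentral κ D]
    [FiniteDimensional κ D] :
    Module.finrank κ D = 1 := by
  let _ : Algebra (LaurentSeries ℂ) D :=
    Algebra.compHom D (algebraMap (LaurentSeries ℂ) κ)
  have : IsScalarTower (LaurentSeries ℂ) κ D := .of_algebraMap_eq' rfl
  have : FiniteDimensional (LaurentSeries ℂ) D :=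
    Module.Finite.trans κ D
  have hcenter : Subalgebra.center κ D = ⊤ := by
    refine eq_top_iff.2 fun x _ ↦ Subalgebra.mem_center_iff.2 fun y ↦ ?_
    exact mul_comm_of_laurentSeries (F := ℂ) y x
  rw [Algebra.IsCentral.center_eq_bot] at hcenter
  exact Subalgebra.bot_eq_top_iff_finrank_eq_one.1 hcenter
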